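/- arXiv:0903.1878 — 18 statements merged into one kernel-verified Lean document; each statement's English description precedes it below -/
import Mathlib

section
/- Let ≻ be a preference relation (strict partial order) on a set U and let CON be a base contractor of ≻ (i.e., CON ⊆ ≻). A relation P⁻ with P⁻ ⊆ ≻ is a full contractor of ≻ by CON if and only if CON ⊆ P⁻ and for every (x,y) ∈ P⁻, the relation ≻ − P⁻ contains no path from x to y. -/
variable {U : Type*}

/-- A strict partial order: irreflexive and transitive binary relation,
represented as a set of pairs. -/
def IsSPO (R : Set (U × U)) : Prop :=
  (∀ x, (x, x) ∉ R) ∧ ∀ x y z, (x, y) ∈ R → (y, z) ∈ R → (x, z) ∈ R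

/-- `f 0, f 1, …, f n` is a path in `R` (of length `n ≥ 1`). -/
def IsPathFun (R : Set (U × U)) (f : ℕ → U) (n : ℕ) : Prop :=
  1 ≤ n ∧ ∀ i < n, (f i, f (i + 1)) ∈ R

/-- `P` is a full contractor of the preference relation `S` by the base contractor `CON`. -/
def FullContractor (S CON P : Set (U × U)) : Prop :=
  CON ⊆ P ∧ P ⊆ S ∧ IsSPO (S \ P)

/-- A minimal full contractor: no proper subset is a full contractor. -/
def MinimalFullContractor (S CON P : Set (U × U)) : Prop :=
  FullContractor S CON P ∧ ∀ P', P' ⊂ P → ¬ FullContractor S CON P'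

theorem full_contractor_iff_no_paths (S CON P : Set (U × U))
    (hS : IsSPO S) (hCON : CON ⊆ S) (hP : P ⊆ S) :
    FullContractor S CON P ↔
      CON ⊆ P ∧ ∀ x y, (x, y) ∈ P →
        ¬ ∃ (f : ℕ → U) (n : ℕ), IsPathFun (S \ P) f n ∧ f 0 = x ∧ f n = y := by
  constructor
  · rintro ⟨h1, _, _, ht⟩
    refine ⟨h1, ?_⟩
    rintro x y hxy ⟨f, n, ⟨hn, hf⟩, rfl, rfl⟩
    have key : ∀ m, 1 ≤ m → m ≤ n → (f 0, f m) ∈ S \ P := by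
      intro m hm
      induction m, hm using Nat.le_induction with
      | base => intro h; exact hf 0 (by omega)
      | succ k hk ih =>
        intro h
        exact ht _ _ _ (ih (by omega)) (hf k (by omega))
    exact (key n hn le_rfl).2 hxy
  · rintro ⟨h1, h2⟩
    refine ⟨h1, hP, fun x hx => hS.1 x hx.1, ?_⟩
    intro x y z hxy hyz
    refine ⟨hS.2 _ _ _ hxy.1 hyz.1, fun hxz => h2 x z hxz ?_⟩
    refine ⟨fun i => if i = 0 then x else if i = 1 then y else z, 2, ⟨by omega, ?_⟩, by simp, by simp⟩
    intro i hi
    interval_cases i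
    · simpa using hxy
    · simpa using hyz
end

section
/- Let P⁻ be a full contractor of a preference relation ≻ by a base contractor CON, and let (x,y) ∈ P⁻ − CON. Then every edge (u,v) in the outer edge set Φ(x,y) satisfies: u ⪰ x and y ⪰ v, and moreover (u,x) ∉ P⁻ and (y,v) ∉ P⁻. -/
variable {U : Type*}

/-- The stages `Φᵢ(x,y)` of the outer edge set of `(x,y)`. -/
def Phi (S P : Set (U × U)) (x y : U) : ℕ → Set (U × U)
  | 0 => {(x, y)}
  | i + 1 => { e ∈ P | ∃ e' ∈ Phi S P x y i,
      (e.1 = e'.1 ∧ (e'.2, e.2) ∈ S \ P) ∨ (e.2 = e'.2 ∧ (e.1, e'.1) ∈ S \ P) }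

/-- The outer edge set `Φ(x,y)`. -/
def OuterEdges (S P : Set (U × U)) (x y : U) : Set (U × U) :=
  ⋃ i, Phi S P x y i

theorem outer_edges_properties (S CON P : Set (U × U))
    (hS : IsSPO S) (hCON : CON ⊆ S)
    (hFC : FullContractor S CON P) (x y : U) (hxy : (x, y) ∈ P \ CON) :
    ∀ u v, (u, v) ∈ OuterEdges S P x y →
      ((u, x) ∈ S ∨ u = x) ∧ ((y, v) ∈ S ∨ y = v) ∧ (u, x) ∉ P ∧ (y, v) ∉ P := by
  have key : ∀ i u v, (u, v) ∈ Phi S P x y i →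
      ((u, x) ∈ S \ P ∨ u = x) ∧ ((y, v) ∈ S \ P ∨ y = v) := by
    intro i
    induction i with
    | zero =>
      intro u v h
      simp only [Phi, Set.mem_singleton_iff, Prod.mk.injEq] at h
      exact ⟨Or.inr h.1, Or.inr h.2.symm⟩
    | succ i ih =>
      rintro u v ⟨-, ⟨a, b⟩, h', h⟩
      obtain ⟨h1, h2⟩ := ih a b h'
      have ht := hFC.2.2.2
      rcases h with ⟨e, h⟩ | ⟨e, h⟩
      · dsimp only at e h
        subst e
        refine ⟨h1, Or.inl ?_⟩
        rcases h2 with h2 | rfl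
        · exact ht _ _ _ h2 h
        · exact h
      · dsimp only at e h
        subst e
        refine ⟨Or.inl ?_, h2⟩
        rcases h1 with h1 | rfl
        · exact ht _ _ _ h h1
        · exact h
  intro u v h
  obtain ⟨i, hi⟩ := Set.mem_iUnion.1 h
  obtain ⟨h1, h2⟩ := key i u v hi
  have hirr : ∀ z, (z, z) ∉ P := fun z hz => hS.1 z (hFC.2.1 hz)
  refine ⟨h1.imp_left And.left, h2.imp_left And.left, ?_, ?_⟩
  · rcases h1 with h1 | rfl
    · exact h1.2
    · exact hirr _
  · rcases h2 with h2 | rfl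
    · exact h2.2
    · exact hirr _
end

section
/- Let P⁻ be a full contractor of a preference relation ≻ by a base contractor CON, and let (x,y) ∈ P⁻ − CON. If the outer edge set Φ(x,y) is disjoint from CON, then P⁻ − Φ(x,y) is a full contractor of ≻ by CON. -/
variable {U : Type*}

theorem remove_outer_edges_full_contractor (S CON P : Set (U × U))
    (hS : IsSPO S) (hCON : CON ⊆ S)
    (hFC : FullContractor S CON P) (x y : U) (hxy : (x, y) ∈ P \ CON)
    (hdisj : OuterEdges S P x y ∩ CON = ∅) :
    FullContractor S CON (P \ OuterEdges S P x y) := by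
  obtain ⟨h1, h2, hI, hT⟩ := hFC
  have hinv : ∀ i, ∀ e ∈ Phi S P x y i,
      (e.1 = x ∨ (e.1, x) ∈ S) ∧ (e.2 = y ∨ (y, e.2) ∈ S) := by
    intro i
    induction i with
    | zero =>
      intro e he
      have he : e = (x, y) := he
      subst he
      exact ⟨Or.inl rfl, Or.inl rfl⟩
    | succ i ih =>
      rintro ⟨a, b⟩ ⟨_, ⟨c, d⟩, he', h | h⟩
      · obtain ⟨h3, h4⟩ := ih _ he'
        obtain ⟨h5, h6, _⟩ := h
        dsimp only at *
        subst h5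
        refine ⟨h3, Or.inr ?_⟩
        rcases h4 with h4 | h4
        · subst h4; exact h6
        · exact hS.2 _ _ _ h4 h6
      · obtain ⟨h3, h4⟩ := ih _ he'
        obtain ⟨h5, h6, _⟩ := h
        dsimp only at *
        subst h5
        refine ⟨Or.inr ?_, h4⟩
        rcases h3 with h3 | h3
        · subst h3; exact h6
        · exact hS.2 _ _ _ h6 h3
  refine ⟨?_, fun e he => h2 he.1, fun a ha => hS.1 a ha.1, ?_⟩
  · intro e he
    refine ⟨h1 he, fun h => ?_⟩
    have : e ∈ OuterEdges S P x y ∩ CON := ⟨h, he⟩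
    rw [hdisj] at this
    exact this
  · intro a b c hab hbc
    refine ⟨hS.2 _ _ _ hab.1 hbc.1, ?_⟩
    rintro ⟨hP, hO⟩
    by_cases p : (a, b) ∈ P
    · have p' : (a, b) ∈ OuterEdges S P x y := by
        by_contra h
        exact hab.2 ⟨p, h⟩
      obtain ⟨i, hi⟩ := Set.mem_iUnion.1 p'
      by_cases q : (b, c) ∈ P
      · have q' : (b, c) ∈ OuterEdges S P x y := by
          by_contra h
          exact hbc.2 ⟨q, h⟩
        obtain ⟨j, hj⟩ := Set.mem_iUnion.1 q'
        have k1 := (hinv i _ hi).2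
        have k2 := (hinv j _ hj).1
        have k3 := h2 hxy.1
        dsimp only at k1 k2
        have k4 : (x, b) ∈ S := by
          rcases k1 with rfl | k1
          · exact k3
          · exact hS.2 _ _ _ k3 k1
        rcases k2 with rfl | k2
        · exact hS.1 _ k4
        · exact hS.1 _ (hS.2 _ _ _ k4 k2)
      · exact hO (Set.mem_iUnion.2 ⟨i + 1, hP, (a, b), hi, Or.inl ⟨rfl, hbc.1, q⟩⟩)
    · by_cases q : (b, c) ∈ P
      · have q' : (b, c) ∈ OuterEdges S P x y := by
          by_contra h
          exact hbc.2 ⟨q, h⟩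
        obtain ⟨j, hj⟩ := Set.mem_iUnion.1 q'
        exact hO (Set.mem_iUnion.2 ⟨j + 1, hP, (b, c), hj, Or.inr ⟨rfl, hab.1, p⟩⟩)
      · exact (hT _ _ _ ⟨hab.1, p⟩ ⟨hbc.1, q⟩).2 hP
end

section
/- (Full-contractor minimality test.) Let P⁻ be a full contractor of a preference relation ≻ by a base contractor CON. Then P⁻ is a minimal full contractor of ≻ by CON if and only if for every (x,y) ∈ P⁻ there is a CON-detour in ≻ in which (x,y) is the only P⁻-edge. -/
variable {U : Type*}

theorem minimality_test (S CON P : Set (U × U))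
    (hS : IsSPO S) (hCON : CON ⊆ S) (hFC : FullContractor S CON P) :
    MinimalFullContractor S CON P ↔
      ∀ x y, (x, y) ∈ P →
        ∃ (f : ℕ → U) (n : ℕ), IsPathFun S f n ∧ (f 0, f n) ∈ CON ∧
          (∃ j < n, f j = x ∧ f (j + 1) = y) ∧
          ∀ i < n, (f i, f (i + 1)) ∈ P → f i = x ∧ f (i + 1) = y := by
  obtain ⟨hCP, hPS, hirr, htr⟩ := hFC
  constructor
  · rintro ⟨-, hmin⟩ x y hxy
    have hxyS := hPS hxy
    let Q : Set (U × U) := {p | (p.1 = x ∨ (p.1, x) ∈ S \ P) ∧ (p.2 = y ∨ (y, p.2) ∈ S \ P)}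
    have hnot := hmin (P \ Q) ⟨Set.diff_subset, fun h => (h hxy).2 ⟨Or.inl rfl, Or.inl rfl⟩⟩
    have hspo : IsSPO (S \ (P \ Q)) := by
      refine ⟨fun a ha => hS.1 a ha.1, ?_⟩
      rintro a b c ⟨hab, hab'⟩ ⟨hbc, hbc'⟩
      refine ⟨hS.2 a b c hab hbc, ?_⟩
      rintro ⟨hac, hacQ⟩
      have h1 : (a, b) ∈ Q ∨ (a, b) ∈ S \ P := by
        by_cases h : (a, b) ∈ Q
        · exact Or.inl h
        · exact Or.inr ⟨hab, fun h' => hab' ⟨h', h⟩⟩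
      have h2 : (b, c) ∈ Q ∨ (b, c) ∈ S \ P := by
        by_cases h : (b, c) ∈ Q
        · exact Or.inl h
        · exact Or.inr ⟨hbc, fun h' => hbc' ⟨h', h⟩⟩
      rcases h1 with ⟨h1, h1'⟩ | h1 <;> rcases h2 with ⟨h2, h2'⟩ | h2
      · exact hacQ ⟨h1, h2'⟩
      · refine hacQ ⟨h1, Or.inr ?_⟩
        rcases h1' with h | h
        · dsimp only at h ⊢
          rw [← h]; exact h2
        · exact htr _ _ _ h h2
      · refine hacQ ⟨Or.inr ?_, h2'⟩
        rcases h2 with h | h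
        · dsimp only at h ⊢
          rw [← h]; exact h1
        · exact htr _ _ _ h1 h
      · exact (htr _ _ _ h1 h2).2 hac
    have hex : ∃ u v, (u, v) ∈ CON ∧ (u, v) ∈ Q := by
      by_contra hne
      push Not at hne
      exact hnot ⟨fun p hp => ⟨hCP hp, hne p.1 p.2 hp⟩, Set.diff_subset.trans hPS, hspo⟩
    obtain ⟨u, v, huv, hu, hv⟩ := hex
    dsimp only at hu hv
    rcases hu with rfl | hu <;> rcases hv with rfl | hv
    · refine ⟨fun i => if i = 0 then u else v, 1, ⟨le_rfl, ?_⟩, by simpa using huv,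
        ⟨0, by simp⟩, ?_⟩
      · intro i hi; interval_cases i; simpa using hxyS
      · intro i hi; interval_cases i; simp
    · refine ⟨fun i => if i = 0 then u else if i = 1 then y else v, 2, ⟨by norm_num, ?_⟩,
        by simpa using huv, ⟨0, by simp⟩, ?_⟩
      · intro i hi; interval_cases i
        · simpa using hxyS
        · simpa using hv.1
      · intro i hi; interval_cases i
        · simp
        · intro h; exact absurd (by simpa using h) hv.2
    · refine ⟨fun i => if i = 0 then u else if i = 1 then x else v, 2, ⟨by norm_num, ?_⟩,
        by simpa using huv, ⟨1, by simp⟩, ?_⟩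
      · intro i hi; interval_cases i
        · simpa using hu.1
        · simpa using hxyS
      · intro i hi; interval_cases i
        · intro h; exact absurd (by simpa using h) hu.2
        · simp
    · refine ⟨fun i => if i = 0 then u else if i = 1 then x else if i = 2 then y else v, 3,
        ⟨by norm_num, ?_⟩, by simpa using huv, ⟨1, by simp⟩, ?_⟩
      · intro i hi; interval_cases i
        · simpa using hu.1
        · simpa using hxyS
        · simpa using hv.1
      · intro i hi; interval_cases i
        · intro h; exact absurd (by simpa using h) hu.2
        · simp
        · intro h; exact absurd (by simpa using h) hv.2
  · intro h
    refine ⟨⟨hCP, hPS, hirr, htr⟩, ?_⟩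
    rintro P' ⟨hsub, hns⟩ ⟨hC', hS', hirr', htr'⟩
    obtain ⟨⟨x, y⟩, hxy, hxy'⟩ := Set.not_subset.1 hns
    obtain ⟨f, n, ⟨hn, hpath⟩, hcon, -, honly⟩ := h x y hxy
    have hedge : ∀ i < n, (f i, f (i + 1)) ∈ S \ P' := by
      intro i hi
      refine ⟨hpath i hi, fun hp => ?_⟩
      obtain ⟨h1, h2⟩ := honly i hi (hsub hp)
      rw [h1, h2] at hp
      exact hxy' hp
    have hall : ∀ k, k + 1 ≤ n → (f 0, f (k + 1)) ∈ S \ P' := by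
      intro k
      induction k with
      | zero => intro hk; exact hedge 0 hk
      | succ k ih => intro hk; exact htr' _ _ _ (ih (by omega)) (hedge (k + 1) hk)
    obtain ⟨k, rfl⟩ : ∃ k, n = k + 1 := ⟨n - 1, by omega⟩
    exact (hall k le_rfl).2 (hC' hcon)
end

section
/- A full contractor P⁻ of a preference relation ≻ by a base contractor CON is minimal if and only if for every edge (x,y) ∈ P⁻ there is a CON-detour consisting of at most three edges among which (x,y) is the only P⁻-edge. -/
variable {U : Type*}

theorem minimality_test_short_detours (S CON P : Set (U × U))
    (hS : IsSPO S) (hCON : CON ⊆ S) (hFC : FullContractor S CON P) :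
    MinimalFullContractor S CON P ↔
      ∀ x y, (x, y) ∈ P →
        ∃ (f : ℕ → U) (n : ℕ), n ≤ 3 ∧ IsPathFun S f n ∧ (f 0, f n) ∈ CON ∧
          (∃ j < n, f j = x ∧ f (j + 1) = y) ∧
          ∀ i < n, (f i, f (i + 1)) ∈ P → f i = x ∧ f (i + 1) = y := by
  obtain ⟨hCP, hPS, hTi, hTt⟩ := hFC
  obtain ⟨hSi, hSt⟩ := hS
  constructor
  · rintro ⟨-, hmin⟩ x y hxy
    have hxyS := hPS hxy
    let Q : Set (U × U) := {p | p ∈ S \ P ∨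
      ((p.1 = x ∨ (p.1, x) ∈ S \ P) ∧ (p.2 = y ∨ (y, p.2) ∈ S \ P))}
    have hQ : ∀ u v, (u, v) ∈ Q ↔ ((u, v) ∈ S \ P ∨
      ((u = x ∨ (u, x) ∈ S \ P) ∧ (v = y ∨ (y, v) ∈ S \ P))) := fun _ _ => Iff.rfl
    have hQS : Q ⊆ S := by
      rintro ⟨u, v⟩ h
      rcases (hQ u v).1 h with h | ⟨h1, h2⟩
      · exact h.1
      · have h3 : (u, y) ∈ S := by
          rcases h1 with rfl | h1
          · exact hxyS
          · exact hSt _ _ _ h1.1 hxyS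
        rcases h2 with rfl | h2
        · exact h3
        · exact hSt _ _ _ h3 h2.1
    have hxQ : (x, y) ∈ Q := (hQ x y).2 (Or.inr ⟨Or.inl rfl, Or.inl rfl⟩)
    have hss : S \ Q ⊂ P := by
      refine ⟨fun p hp => ?_, fun h => (h hxy).2 hxQ⟩
      by_contra hpP
      exact hp.2 (Or.inl ⟨hp.1, hpP⟩)
    have hQspo : IsSPO (S \ (S \ Q)) := by
      rw [Set.diff_diff_cancel_left hQS]
      refine ⟨fun a ha => hSi a (hQS ha), fun a b c hab hbc => ?_⟩
      rcases (hQ a b).1 hab with h1 | ⟨h1, h2⟩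
      · rcases (hQ b c).1 hbc with h3 | ⟨h3, h4⟩
        · exact (hQ a c).2 (Or.inl (hTt _ _ _ h1 h3))
        · refine (hQ a c).2 (Or.inr ⟨Or.inr ?_, h4⟩)
          rcases h3 with rfl | h3
          · exact h1
          · exact hTt _ _ _ h1 h3
      · rcases (hQ b c).1 hbc with h3 | ⟨h3, h4⟩
        · refine (hQ a c).2 (Or.inr ⟨h1, Or.inr ?_⟩)
          rcases h2 with rfl | h2
          · exact h3
          · exact hTt _ _ _ h2 h3
        · exfalso
          have h5 : (x, b) ∈ S := by
            rcases h2 with rfl | h2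
            · exact hxyS
            · exact hSt _ _ _ hxyS h2.1
          rcases h3 with rfl | h3
          · exact hSi _ h5
          · exact hSi _ (hSt _ _ _ h5 h3.1)
    have hnot : ¬ CON ⊆ S \ Q := fun h => hmin _ hss ⟨h, Set.diff_subset, hQspo⟩
    obtain ⟨⟨u, v⟩, huv, hn⟩ := Set.not_subset.1 hnot
    have huvQ : (u, v) ∈ Q := by
      by_contra h
      exact hn ⟨hCON huv, h⟩
    rcases (hQ u v).1 huvQ with h | ⟨h1, h2⟩
    · exact absurd (hCP huv) h.2
    · rcases h1 with rfl | h1 <;> rcases h2 with rfl | h2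
      · refine ⟨fun i => if i = 0 then u else v, 1, by omega, ⟨le_rfl, ?_⟩, by simpa using huv,
          ⟨0, by simp⟩, ?_⟩
        · intro i hi; interval_cases i; simpa using hxyS
        · intro i hi _; interval_cases i; simp
      · refine ⟨fun i => if i = 0 then u else if i = 1 then y else v, 2, by omega,
          ⟨by omega, ?_⟩, by simpa using huv, ⟨0, by simp⟩, ?_⟩
        · intro i hi; interval_cases i
          · simpa using hxyS
          · simpa using h2.1
        · intro i hi h; interval_cases i
          · simp
          · exact absurd (by simpa using h) h2.2
      · refine ⟨fun i => if i = 0 then u else if i = 1 then x else v, 2, by omega,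
          ⟨by omega, ?_⟩, by simpa using huv, ⟨1, by simp⟩, ?_⟩
        · intro i hi; interval_cases i
          · simpa using h1.1
          · simpa using hxyS
        · intro i hi h; interval_cases i
          · exact absurd (by simpa using h) h1.2
          · simp
      · refine ⟨fun i => if i = 0 then u else if i = 1 then x else if i = 2 then y else v, 3,
          by omega, ⟨by omega, ?_⟩, by simpa using huv, ⟨1, by simp⟩, ?_⟩
        · intro i hi; interval_cases i
          · simpa using h1.1
          · simpa using hxyS
          · simpa using h2.1
        · intro i hi h; interval_cases i
          · exact absurd (by simpa using h) h1.2
          · simp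
          · exact absurd (by simpa using h) h2.2
  · intro H
    refine ⟨⟨hCP, hPS, hTi, hTt⟩, ?_⟩
    rintro P' hP' ⟨hC', -, -, ht'⟩
    obtain ⟨⟨x, y⟩, hxy, hn⟩ := Set.exists_of_ssubset hP'
    obtain ⟨f, n, -, ⟨hn1, hp⟩, hc, -, honly⟩ := H x y hxy
    have he : ∀ i < n, (f i, f (i + 1)) ∈ S \ P' := by
      intro i hi
      refine ⟨hp i hi, fun h => ?_⟩
      obtain ⟨h1, h2⟩ := honly i hi (hP'.1 h)
      rw [h1, h2] at h
      exact hn h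
    have hpath : ∀ k, k < n → (f 0, f (k + 1)) ∈ S \ P' := by
      intro k
      induction k with
      | zero => exact fun h => he 0 h
      | succ k ih => exact fun h => ht' _ _ _ (ih (by omega)) (he (k + 1) h)
    have h := hpath (n - 1) (by omega)
    rw [Nat.sub_add_cancel hn1] at h
    exact h.2 (hC' hc)
end

section
/- Let ≻ be a preference relation on U and CON a base contractor of ≻. Then the relation P⁻ := {(x,y) | ∃(x',v) ∈ CON such that x' = x, x ≻ y, and y ⪰ v} is a full contractor of ≻ by CON. -/
variable {U : Type*}

theorem starting_edges_full_contractor (S CON : Set (U × U))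
    (hS : IsSPO S) (hCON : CON ⊆ S) :
    FullContractor S CON
      {e : U × U | ∃ x' v, (x', v) ∈ CON ∧ x' = e.1 ∧ (x', e.2) ∈ S ∧
        ((e.2, v) ∈ S ∨ e.2 = v)} := by
  refine ⟨?_, ?_, ?_, ?_⟩
  · rintro ⟨x, v⟩ h
    exact ⟨x, v, h, rfl, hCON h, Or.inr rfl⟩
  · rintro ⟨x, y⟩ ⟨x', v, _, rfl, h, _⟩
    exact h
  · intro x h
    exact hS.1 x h.1
  · intro x y z hxy hyz
    refine ⟨hS.2 x y z hxy.1 hyz.1, ?_⟩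
    rintro ⟨x', v, hc, rfl, _, hv⟩
    apply hxy.2
    refine ⟨_, v, hc, rfl, hxy.1, Or.inl ?_⟩
    rcases hv with hv | hv
    · exact hS.2 y z v hyz.1 hv
    · have hv' : z = v := hv
      exact hv' ▸ hyz.1
end

section
/- (Minimal full contractor construction.) Let ≻ be a preference relation on U and CON a stratifiable base contractor of ≻. For each i ≥ 0 let Lᵢ be the set of end nodes of the CON-edges of layer index i. Define P⁻₋₁ = ∅ and, recursively for i ≥ 0, Eᵢ = {(x,y) | ∃v ∈ Lᵢ such that (x,v) ∈ CON, x ≻ y, y ⪰ v, and (y,v) ∉ P⁻ᵢ₋₁ ∪ CON}, with P⁻ᵢ = E₀ ∪ … ∪ Eᵢ. Then P⁻ = ∪_{i≥0} Eᵢ is a minimal full contractor of ≻ by CON. -/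
variable {U : Type*}

/-- The set of end nodes of `CON`-edges. -/
def Kset (CON : Set (U × U)) : Set U := {y | ∃ x, (x, y) ∈ CON}

/-- The restriction `≻_CON` of `S` to `K_CON × K_CON`. -/
def restrictRel (S CON : Set (U × U)) : Set (U × U) :=
  {e ∈ S | e.1 ∈ Kset CON ∧ e.2 ∈ Kset CON}

/-- `CON` is stratifiable w.r.t. `S`. -/
def Stratifiable (S CON : Set (U × U)) : Prop :=
  ∀ y ∈ Kset CON, ∃ k, ∀ (f : ℕ → U) (n : ℕ),
    IsPathFun (restrictRel S CON) f n → f 0 = y → n ≤ k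

/-- `CON` is finitely stratifiable w.r.t. `S`. -/
def FinStratifiable (S CON : Set (U × U)) : Prop :=
  ∃ k, ∀ (f : ℕ → U) (n : ℕ), IsPathFun (restrictRel S CON) f n → n ≤ k

/-- `i` is the layer index of the node `y` w.r.t. the relation `R = ≻_CON`:
the maximum length of an `R`-path started by `y` (`0` if there is none). -/
def LayerIndexIs (R : Set (U × U)) (y : U) (i : ℕ) : Prop :=
  (∀ (f : ℕ → U) (n : ℕ), IsPathFun R f n → f 0 = y → n ≤ i) ∧
  (i = 0 ∨ ∃ f : ℕ → U, IsPathFun R f i ∧ f 0 = y)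

/-- The set `Lᵢ` of end nodes of `CON`-edges of layer index `i`. -/
def Lset (SC CON : Set (U × U)) (i : ℕ) : Set U :=
  {v | (∃ x, (x, v) ∈ CON) ∧ LayerIndexIs SC v i}

/-- `Eᵢ`, given the previously constructed part `prev = P⁻ᵢ₋₁`. -/
def Enew (S CON SC prev : Set (U × U)) (i : ℕ) : Set (U × U) :=
  { e : U × U | ∃ v ∈ Lset SC CON i, (e.1, v) ∈ CON ∧ e ∈ S ∧
      ((e.2, v) ∈ S ∨ e.2 = v) ∧ (e.2, v) ∉ prev ∪ CON }

/-- `P⁻ᵢ = E₀ ∪ … ∪ Eᵢ`. -/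
def Pstage (S CON SC : Set (U × U)) : ℕ → Set (U × U)
  | 0 => Enew S CON SC ∅ 0
  | i + 1 => Pstage S CON SC i ∪ Enew S CON SC (Pstage S CON SC i) (i + 1)

/-- `Eᵢ`. -/
def Estage (S CON SC : Set (U × U)) : ℕ → Set (U × U)
  | 0 => Enew S CON SC ∅ 0
  | i + 1 => Enew S CON SC (Pstage S CON SC i) (i + 1)

theorem aux_exists_layer (S CON : Set (U × U)) (hstrat : Stratifiable S CON) (v : U)
    (hv : v ∈ Kset CON) : ∃ i, LayerIndexIs (restrictRel S CON) v i := by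
  classical
  have h := hstrat v hv
  refine ⟨Nat.find h, Nat.find_spec h, ?_⟩
  rcases Nat.eq_zero_or_pos (Nat.find h) with h0 | h0
  · exact Or.inl h0
  · right
    have hm := Nat.find_min h (m := Nat.find h - 1) (by omega)
    push Not at hm
    obtain ⟨f, n, hp, hf, hn⟩ := hm
    have h2 := Nat.find_spec h f n hp hf
    have h3 : n = Nat.find h := by omega
    exact ⟨f, h3 ▸ hp, hf⟩

theorem aux_layer_lt (R : Set (U × U)) (v w : U) (h : (v, w) ∈ R) (i j : ℕ)
    (hi : LayerIndexIs R v i) (hj : LayerIndexIs R w j) : j < i := by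
  rcases hj.2 with h0 | ⟨f, hf, hf0⟩
  · have := hi.1 (fun n => if n = 0 then v else w) 1
      ⟨le_refl _, by intro k hk; obtain rfl : k = 0 := by omega
                     simpa using h⟩ (by simp)
    omega
  · have := hi.1 (fun n => if n = 0 then v else f (n - 1)) (j + 1)
      ⟨by omega, by
        intro k hk
        rcases k with _ | k
        · simpa [hf0] using h
        · simpa using hf.2 k (by omega)⟩ (by simp)
    omega

theorem aux_mem_Pstage (S CON SC : Set (U × U)) (i : ℕ) (e : U × U) :
    e ∈ Pstage S CON SC i ↔ ∃ j ≤ i, e ∈ Estage S CON SC j := by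
  induction i with
  | zero => simp [Pstage, Estage]
  | succ i ih =>
    have : Pstage S CON SC (i+1) = Pstage S CON SC i ∪ Estage S CON SC (i+1) := rfl
    rw [this, Set.mem_union, ih]
    constructor
    · rintro (⟨j, hj, h⟩ | h)
      · exact ⟨j, by omega, h⟩
      · exact ⟨i+1, le_refl _, h⟩
    · rintro ⟨j, hj, h⟩
      rcases Nat.lt_or_ge i j with h1 | h1
      · obtain rfl : j = i + 1 := by omega
        exact Or.inr h
      · exact Or.inl ⟨j, h1, h⟩

theorem aux_mem_Estage (S CON SC : Set (U × U)) (i : ℕ) (x y : U) :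
    (x, y) ∈ Estage S CON SC i ↔ ∃ v ∈ Lset SC CON i, (x, v) ∈ CON ∧ (x, y) ∈ S ∧
      ((y, v) ∈ S ∨ y = v) ∧ (y, v) ∉ CON ∧ ∀ j < i, (y, v) ∉ Estage S CON SC j := by
  rcases i with _ | i
  · simp [Estage, Enew]
  · have : Estage S CON SC (i+1) = Enew S CON SC (Pstage S CON SC i) (i+1) := rfl
    rw [this]
    simp only [Enew, Set.mem_setOf_eq, Set.mem_union, aux_mem_Pstage, not_or, not_exists, not_and,
      Nat.lt_succ_iff]
    grind

theorem aux_char (S CON : Set (U × U))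
    (hS : IsSPO S) (hCON : CON ⊆ S) (hstrat : Stratifiable S CON)
    (P : Set (U × U)) (hP : P = ⋃ i, Estage S CON (restrictRel S CON) i) :
    CON ⊆ P ∧ ∀ x y, (x, y) ∈ P ↔ (x, y) ∈ S ∧ ∃ v, (x, v) ∈ CON ∧ ((y, v) ∈ S ∨ y = v) ∧
      (y, v) ∉ P := by
  have hsub : P ⊆ S := by
    rintro ⟨x, y⟩ h
    rw [hP, Set.mem_iUnion] at h
    obtain ⟨i, h⟩ := h
    rw [aux_mem_Estage] at h
    obtain ⟨v, _, _, h, _⟩ := h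
    exact h
  have hc : CON ⊆ P := by
    rintro ⟨x, v⟩ h
    obtain ⟨i, hi⟩ := aux_exists_layer S CON hstrat v ⟨x, h⟩
    rw [hP, Set.mem_iUnion]
    refine ⟨i, (aux_mem_Estage ..).2 ⟨v, ⟨⟨x, h⟩, hi⟩, h, hCON h, Or.inr rfl,
      fun h' => hS.1 v (hCON h'), fun j _ h' => hS.1 v (hsub ?_)⟩⟩
    rw [hP]; exact Set.mem_iUnion.2 ⟨j, h'⟩
  refine ⟨hc, fun x y => ⟨fun h => ⟨hsub h, ?_⟩, ?_⟩⟩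
  · have h' := h
    rw [hP, Set.mem_iUnion] at h'
    obtain ⟨i, h'⟩ := h'
    rw [aux_mem_Estage] at h'
    obtain ⟨v, hv, h1, h2, h3, h4, h5⟩ := h'
    refine ⟨v, h1, h3, fun h6 => ?_⟩
    rw [hP, Set.mem_iUnion] at h6
    obtain ⟨j, h6⟩ := h6
    have h7 := h6
    rw [aux_mem_Estage] at h7
    obtain ⟨w, hw, g1, g2, g3, g4, g5⟩ := h7
    rcases g3 with g3 | rfl
    · exact h5 j (aux_layer_lt (restrictRel S CON) v w ⟨g3, ⟨x, h1⟩, ⟨y, g1⟩⟩ i j hv.2 hw.2) h6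
    · exact h4 g1
  · rintro ⟨h, v, h1, h2, h3⟩
    obtain ⟨i, hi⟩ := aux_exists_layer S CON hstrat v ⟨x, h1⟩
    rw [hP, Set.mem_iUnion]
    refine ⟨i, (aux_mem_Estage ..).2 ⟨v, ⟨⟨x, h1⟩, hi⟩, h1, h, h2,
      fun h' => h3 (hc h'), fun j _ h' => h3 ?_⟩⟩
    rw [hP]; exact Set.mem_iUnion.2 ⟨j, h'⟩

theorem minimal_full_contractor_construction (S CON : Set (U × U))
    (hS : IsSPO S) (hCON : CON ⊆ S) (hstrat : Stratifiable S CON) :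
    MinimalFullContractor S CON (⋃ i, Estage S CON (restrictRel S CON) i) := by
  obtain ⟨hc, hchar⟩ := aux_char S CON hS hCON hstrat _ rfl
  generalize (⋃ i, Estage S CON (restrictRel S CON) i) = P at hc hchar ⊢
  have hsub : P ⊆ S := fun ⟨x, y⟩ h => ((hchar x y).1 h).1
  have tr := hS.2
  have step : ∀ x y z, (x, y) ∈ S → (y, z) ∈ S → (x, y) ∉ P → (y, z) ∉ P → (x, z) ∈ P →
      ∃ v w, v ∈ Kset CON ∧ w ∈ Kset CON ∧ (z, v) ∈ S ∧ (v, w) ∈ S ∧ (z, v) ∉ P ∧ (v, w) ∉ P ∧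
        (z, w) ∈ P := by
    intro x y z hxy hyz nxy nyz hxz
    obtain ⟨hxzS, v, hv, hzv, nzv⟩ := (hchar x z).1 hxz
    have hyv : (y, v) ∈ S := by
      rcases hzv with h | rfl
      · exact tr _ _ _ hyz h
      · exact hyz
    have hyvP : (y, v) ∈ P := by
      by_contra h
      exact nxy ((hchar x y).2 ⟨hxy, v, hv, Or.inl hyv, h⟩)
    obtain ⟨_, w, hw, hvw, nvw⟩ := (hchar y v).1 hyvP
    have hzw : (z, w) ∈ S ∨ z = w := by
      rcases hzv with h | rfl
      · rcases hvw with h' | rfl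
        · exact Or.inl (tr _ _ _ h h')
        · exact Or.inl h
      · exact hvw
    have hzwP : (z, w) ∈ P := by
      by_contra h
      exact nyz ((hchar y z).2 ⟨hyz, w, hw, hzw, h⟩)
    rcases hzv with h | rfl
    · rcases hvw with h' | rfl
      · exact ⟨v, w, ⟨x, hv⟩, ⟨y, hw⟩, h, h', nzv, nvw, hzwP⟩
      · exact absurd hzwP nzv
    · exact absurd hzwP nvw
  have main : ∀ n z, z ∈ Kset CON → LayerIndexIs (restrictRel S CON) z n →
      ∀ x y, (x, y) ∈ S → (y, z) ∈ S → (x, y) ∉ P → (y, z) ∉ P → (x, z) ∉ P := by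
    intro n
    induction n using Nat.strong_induction_on with
    | _ n ih =>
      intro z hz hn x y h1 h2 h3 h4 h5
      obtain ⟨v, w, hv, hw, g1, g2, g3, g4, g5⟩ := step x y z h1 h2 h3 h4 h5
      obtain ⟨j, hj⟩ := aux_exists_layer S CON hstrat w hw
      exact ih j (aux_layer_lt (restrictRel S CON) z w ⟨hsub g5, hz, hw⟩ n j hn hj) w hw hj z v g1 g2 g3 g4 g5
  refine ⟨⟨hc, hsub, fun x h => hS.1 x h.1, ?_⟩, ?_⟩
  · rintro x y z ⟨h1, h3⟩ ⟨h2, h4⟩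
    refine ⟨tr _ _ _ h1 h2, fun h5 => ?_⟩
    obtain ⟨v, w, hv, hw, g1, g2, g3, g4, g5⟩ := step x y z h1 h2 h3 h4 h5
    obtain ⟨j, hj⟩ := aux_exists_layer S CON hstrat w hw
    exact main j w hw hj z v g1 g2 g3 g4 g5
  · rintro P' hP' ⟨hc', hs', _, ht'⟩
    obtain ⟨⟨x, y⟩, hxy, nxy⟩ := Set.exists_of_ssubset hP'
    obtain ⟨hS', v, hv, hyv, nyv⟩ := (hchar x y).1 hxy
    rcases hyv with h | rfl
    · exact (ht' x y v ⟨hS', nxy⟩ ⟨h, fun h' => nyv (hP'.1 h')⟩).2 (hc' hv)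
    · exact nxy (hc' hv)
end

section
/- Given a preference relation ≻ on U and a stratifiable base contractor CON of ≻, there exists a unique prefix full contractor of ≻ by CON. -/
variable {U : Type*}

/-- `P` is a prefix full contractor of `S` by `C`: every edge `(x,y) ∈ P` starts
some `C`-detour in which `(x,y)` is the only `P`-edge. -/
def PrefixContractor (S C P : Set (U × U)) : Prop :=
  FullContractor S C P ∧ ∀ x y, (x, y) ∈ P →
    ∃ (f : ℕ → U) (n : ℕ), IsPathFun S f n ∧ f 0 = x ∧ f 1 = y ∧ (f 0, f n) ∈ C ∧
      ∀ i < n, (f i, f (i + 1)) ∈ P → f i = x ∧ f (i + 1) = y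

def FixEq (S C P : Set (U × U)) : Prop :=
  ∀ x y, (x, y) ∈ P ↔ (x, y) ∈ S ∧ ∃ v, (x, v) ∈ C ∧ (y = v ∨ (y, v) ∈ S \ P)

theorem strat_wf (S C : Set (U × U)) (h : Stratifiable S C) :
    WellFounded (fun w v : U => (v, w) ∈ restrictRel S C) := by
  rw [wellFounded_iff_isEmpty_descending_chain]
  refine ⟨fun ⟨f, hf⟩ => ?_⟩
  obtain ⟨k, hk⟩ := h (f 0) (hf 0).2.1
  have := hk f (k + 1) ⟨by omega, fun i _ => hf i⟩ rfl
  omega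

theorem prefix_fix (S C P : Set (U × U)) (hS : IsSPO S)
    (hP : PrefixContractor S C P) : FixEq S C P := by
  obtain ⟨⟨hCP, hPS, hir, htr⟩, hpre⟩ := hP
  intro x y
  constructor
  · intro hxy
    refine ⟨hPS hxy, ?_⟩
    obtain ⟨f, n, ⟨hn, hf⟩, h0, h1, hc, hu⟩ := hpre x y hxy
    have hx : ∀ m, 1 ≤ m → m ≤ n → (f 0, f m) ∈ S := by
      intro m hm
      induction m, hm using Nat.le_induction with
      | base => intro h; exact hf 0 (by omega)
      | succ m hm ih =>
        intro h
        exact hS.2 _ _ _ (ih (by omega)) (hf m (by omega))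
    have hy : ∀ m, 1 ≤ m → m ≤ n → (f 1 = f m ∨ (f 1, f m) ∈ S \ P) := by
      intro m hm
      induction m, hm using Nat.le_induction with
      | base => intro h; exact Or.inl rfl
      | succ m hm ih =>
        intro h
        have e : (f m, f (m + 1)) ∈ S \ P := by
          refine ⟨hf m (by omega), fun hp => ?_⟩
          have h2 := (hu m (by omega) hp).1
          have h3 := hx m hm (by omega)
          rw [h2, h0] at h3
          exact hS.1 _ h3
        right
        rcases ih (by omega) with h2 | h2
        · rw [h2]; exact e
        · exact htr _ _ _ h2 e
    refine ⟨f n, h0 ▸ hc, ?_⟩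
    have := hy n hn le_rfl
    rwa [h1] at this
  · rintro ⟨hs, v, hv, rfl | h⟩
    · exact hCP hv
    · by_contra hn
      exact (htr _ _ _ ⟨hs, hn⟩ h).2 (hCP hv)

theorem fix_prefix (S C P : Set (U × U)) (hS : IsSPO S) (hC : C ⊆ S)
    (hw : WellFounded (fun w v : U => (v, w) ∈ restrictRel S C))
    (hP : FixEq S C P) : PrefixContractor S C P := by
  have key : ∀ v, v ∈ Kset C → ∀ y z, (y, z) ∈ S \ P → (z, v) ∈ S \ P → (y, v) ∉ P := by
    intro v
    induction v using hw.induction with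
    | _ v ih =>
    intro hv y z hyz hzv hyv
    obtain ⟨_, w, hcw, rfl | h⟩ := (hP _ _).1 hyv
    · exact hyz.2 ((hP _ _).2 ⟨hyz.1, v, hcw, Or.inr hzv⟩)
    · have := ih w ⟨h.1, hv, ⟨y, hcw⟩⟩ ⟨y, hcw⟩ z v hzv h
      exact hyz.2 ((hP _ _).2 ⟨hyz.1, w, hcw, Or.inr ⟨hS.2 _ _ _ hzv.1 h.1, this⟩⟩)
  refine ⟨⟨?_, fun e he => ((hP e.1 e.2).1 he).1, fun x h => hS.1 x h.1, ?_⟩, ?_⟩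
  · rintro ⟨x, y⟩ h
    exact (hP _ _).2 ⟨hC h, y, h, Or.inl rfl⟩
  · intro x y z hxy hyz
    refine ⟨hS.2 _ _ _ hxy.1 hyz.1, fun hxz => ?_⟩
    obtain ⟨_, v, hcv, rfl | h⟩ := (hP _ _).1 hxz
    · exact hxy.2 ((hP _ _).2 ⟨hxy.1, z, hcv, Or.inr hyz⟩)
    · exact hxy.2 ((hP _ _).2 ⟨hxy.1, v, hcv, Or.inr ⟨hS.2 _ _ _ hyz.1 h.1,
        key v ⟨x, hcv⟩ y z hyz h⟩⟩)
  · intro x y hxy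
    obtain ⟨hs, v, hcv, rfl | h⟩ := (hP _ _).1 hxy
    · refine ⟨fun i => if i = 0 then x else y, 1, ⟨le_rfl, ?_⟩, by simp, by simp, by simpa, ?_⟩
      · intro i hi
        obtain rfl : i = 0 := by omega
        simpa
      · intro i hi
        obtain rfl : i = 0 := by omega
        simp
    · refine ⟨fun i => if i = 0 then x else if i = 1 then y else v, 2, ⟨by omega, ?_⟩,
        by simp, by simp, by simpa, ?_⟩
      · intro i hi
        obtain rfl | rfl : i = 0 ∨ i = 1 := by omega
        · simpa
        · simpa using h.1
      · intro i hi
        obtain rfl | rfl : i = 0 ∨ i = 1 := by omega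
        · simp
        · intro hh
          exact absurd (by simpa using hh) h.2

theorem fix_unique (S C P P' : Set (U × U))
    (hw : WellFounded (fun w v : U => (v, w) ∈ restrictRel S C))
    (hP : FixEq S C P) (hP' : FixEq S C P') : P = P' := by
  have key : ∀ v, v ∈ Kset C → ∀ y, (y, v) ∈ P ↔ (y, v) ∈ P' := by
    intro v
    induction v using hw.induction with
    | _ v ih =>
    intro hv y
    rw [hP, hP']
    refine and_congr_right fun _ => exists_congr fun w => and_congr_right fun hc =>
      or_congr_right (and_congr_right fun hs => not_congr ?_)
    exact ih w ⟨hs, hv, ⟨y, hc⟩⟩ ⟨y, hc⟩ v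
  ext ⟨x, y⟩
  rw [hP, hP']
  refine and_congr_right fun _ => exists_congr fun w => and_congr_right fun hc =>
    or_congr_right (and_congr_right fun hs => not_congr ?_)
  exact key w ⟨x, hc⟩ y

theorem fix_exists (S C : Set (U × U))
    (hw : WellFounded (fun w v : U => (v, w) ∈ restrictRel S C)) :
    ∃ P, FixEq S C P := by
  let F : ∀ v : U, (∀ w : U, (v, w) ∈ restrictRel S C → U → Prop) → U → Prop :=
    fun v Q y => (y, v) ∈ S ∧ ∃ w, (y, w) ∈ C ∧
      (v = w ∨ ∃ h : (v, w) ∈ restrictRel S C, ¬ Q w h v)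
  let Q : U → U → Prop := hw.fix F
  have hQ : ∀ v y, Q v y ↔ ((y, v) ∈ S ∧ ∃ w, (y, w) ∈ C ∧
      (v = w ∨ ∃ h : (v, w) ∈ restrictRel S C, ¬ Q w v)) := by
    intro v y
    have : Q v = F v (fun w _ => Q w) := hw.fix_eq F v
    rw [this]
  let P : Set (U × U) := {e | e ∈ S ∧ ∃ v, (e.1, v) ∈ C ∧
    (e.2 = v ∨ ((e.2, v) ∈ S ∧ ¬ Q v e.2))}
  have hPQ : ∀ v, v ∈ Kset C → ∀ y, (y, v) ∈ P ↔ Q v y := by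
    intro v hv y
    rw [hQ]
    refine and_congr_right fun _ => exists_congr fun w => and_congr_right fun hc =>
      or_congr_right ?_
    constructor
    · rintro ⟨h1, h2⟩
      exact ⟨⟨h1, hv, ⟨y, hc⟩⟩, h2⟩
    · rintro ⟨h1, h2⟩
      exact ⟨h1.1, h2⟩
  refine ⟨P, fun x y => and_congr_right fun _ => exists_congr fun w => and_congr_right fun hc =>
    or_congr_right (and_congr_right fun hs => not_congr ?_)⟩
  exact (hPQ w ⟨x, hc⟩ y).symm

theorem prefix_full_contractor_exists_unique (S CON : Set (U × U))
    (hS : IsSPO S) (hCON : CON ⊆ S) (hstrat : Stratifiable S CON) :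
    ∃! P : Set (U × U), PrefixContractor S CON P := by
  have hw := strat_wf S CON hstrat
  obtain ⟨P, hP⟩ := fix_exists S CON hw
  exact ⟨P, fix_prefix S CON P hS hCON hw hP, fun P' hP' =>
    fix_unique S CON P' P hw (prefix_fix S CON P' hS hP') hP⟩
end

section
/- Let CON be a stratifiable base contractor of a preference relation ≻ on U, and let P⁺ ⊂ ≻. There exists a minimal full contractor of ≻ by CON that protects P⁺ (i.e., is disjoint from P⁺) if and only if TC(P⁺) ∩ CON = ∅, where TC(P⁺) is the transitive closure of P⁺. -/
variable {U : Type*}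

theorem protecting_minimal_contractor_exists_iff (S CON Pplus : Set (U × U))
    (hS : IsSPO S) (hCON : CON ⊆ S) (hstrat : Stratifiable S CON)
    (hPplus : Pplus ⊆ S) :
    (∃ P, MinimalFullContractor S CON P ∧ Pplus ∩ P = ∅) ↔
      {e : U × U | Relation.TransGen (fun a b => (a, b) ∈ Pplus) e.1 e.2} ∩ CON = ∅ := by
  constructor
  · rintro ⟨P, ⟨⟨hC, hPS, hirr, htr⟩, -⟩, hdisj⟩
    ext ⟨x, y⟩
    simp only [Set.mem_inter_iff, Set.mem_setOf_eq, Set.mem_empty_iff_false, iff_false, not_and]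
    intro hT hxy
    have base : ∀ a b, (a, b) ∈ Pplus → (a, b) ∈ S \ P := fun a b h =>
      ⟨hPplus h, fun hp => by
        have : (a, b) ∈ Pplus ∩ P := ⟨h, hp⟩
        rw [hdisj] at this
        exact this⟩
    have key : (x, y) ∈ S \ P := by
      clear hxy
      induction hT with
      | single h => exact base _ _ h
      | tail _ h ih => exact htr _ _ _ ih (base _ _ h)
    exact key.2 (hC hxy)
  · intro h
    set T : Set (U × U) := {e : U × U | Relation.TransGen (fun a b => (a, b) ∈ Pplus) e.1 e.2}
      with hT
    have hTS : T ⊆ S := by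
      rintro ⟨x, y⟩ hxy
      change Relation.TransGen _ x y at hxy
      induction hxy with
      | single h => exact hPplus h
      | tail _ h ih => exact hS.2 _ _ _ ih (hPplus h)
    let F : Set (Set (U × U)) := {R | R ⊆ S ∧ R ∩ CON = ∅ ∧
      ∀ x y z, (x, y) ∈ R → (y, z) ∈ R → (x, z) ∈ R}
    have hTF : T ∈ F := ⟨hTS, h, fun x y z h1 h2 => Relation.TransGen.trans h1 h2⟩
    obtain ⟨R, hTR, hR⟩ := zorn_subset_nonempty F (by
      intro c hcF hc _
      refine ⟨⋃₀ c, ⟨Set.sUnion_subset fun s hs => (hcF hs).1, ?_, ?_⟩,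
        fun s hs => Set.subset_sUnion_of_mem hs⟩
      · ext e
        simp only [Set.mem_inter_iff, Set.mem_empty_iff_false, iff_false, not_and]
        rintro ⟨s, hs, he⟩ hC
        have : e ∈ s ∩ CON := ⟨he, hC⟩
        rw [(hcF hs).2.1] at this
        exact this
      · rintro x y z ⟨s, hs, h1⟩ ⟨t, ht, h2⟩
        rcases hc.total hs ht with hst | hst
        · exact ⟨t, ht, (hcF ht).2.2 _ _ _ (hst h1) h2⟩
        · exact ⟨s, hs, (hcF hs).2.2 _ _ _ h1 (hst h2)⟩) T hTF
    obtain ⟨hRS, hRC, hRt⟩ := hR.prop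
    have hSR : S \ (S \ R) = R := by
      rw [Set.diff_diff_cancel_left hRS]
    refine ⟨S \ R, ⟨⟨?_, Set.diff_subset, ?_⟩, ?_⟩, ?_⟩
    · intro e he
      refine ⟨hCON he, fun hr => ?_⟩
      have : e ∈ R ∩ CON := ⟨hr, he⟩
      rw [hRC] at this
      exact this
    · rw [hSR]
      exact ⟨fun x hx => hS.1 x (hRS hx), hRt⟩
    · rintro P' hP' ⟨hC, hPS, -, htr⟩
      have hle : R ⊆ S \ P' := fun e he => ⟨hRS he, fun hp => (hP'.1 hp).2 he⟩
      have hF : S \ P' ∈ F := ⟨Set.diff_subset, by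
        ext e
        simp only [Set.mem_inter_iff, Set.mem_empty_iff_false, iff_false, not_and]
        exact fun he hc => he.2 (hC hc), htr⟩
      have hge := hR.le_of_ge hF hle
      exact hP'.2 fun e he => by
        by_contra hn
        exact he.2 (hge ⟨he.1, hn⟩)
    · ext ⟨x, y⟩
      simp only [Set.mem_inter_iff, Set.mem_empty_iff_false, iff_false, not_and]
      exact fun hp hn => hn.2 (hTR (Relation.TransGen.single hp))
end

section
/- Let ≻ be a preference relation on U, CON a stratifiable base contractor of ≻, and P⁺ a transitive relation with P⁺ ⊆ ≻ and P⁺ ∩ CON = ∅. Define Q = {(x,y) | ∃u : u ≻ x ≻ y, (u,y) ∈ CON, and (u,x) ∈ P⁺}. Then the prefix full contractor of ≻ by CON ∪ Q is a P⁺-protecting minimal full contractor of ≻ by CON. -/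
variable {U : Type*}

theorem prefix_of_union_is_protecting_minimal (S CON Pplus Q P : Set (U × U))
    (hS : IsSPO S) (hCON : CON ⊆ S) (hstrat : Stratifiable S CON)
    (hPtrans : ∀ x y z, (x, y) ∈ Pplus → (y, z) ∈ Pplus → (x, z) ∈ Pplus)
    (hPsub : Pplus ⊆ S) (hPdisj : Pplus ∩ CON = ∅)
    (hQ : Q = {e : U × U | ∃ u, (u, e.1) ∈ S ∧ (e.1, e.2) ∈ S ∧
      (u, e.2) ∈ CON ∧ (u, e.1) ∈ Pplus})
    (hP : PrefixContractor S (CON ∪ Q) P) :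
    MinimalFullContractor S CON P ∧ Pplus ∩ P = ∅ := by
  obtain ⟨⟨hCP, hPS, hirr, htr⟩, hpre⟩ := hP
  have key : ∀ x y, (x, y) ∈ P → ∃ z, (x, z) ∈ CON ∪ Q ∧ (y = z ∨ (y, z) ∈ S \ P) := by
    intro x y hxy
    obtain ⟨f, n, ⟨hn, hf⟩, h0, h1, hC, hu⟩ := hpre x y hxy
    have hS0 : ∀ i, i < n → (f 0, f (i + 1)) ∈ S := by
      intro i
      induction i with
      | zero => intro h; exact hf 0 h
      | succ k ih => intro h; exact hS.2 _ _ _ (ih (by omega)) (hf _ h)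
    have hnot : ∀ i, 1 ≤ i → i < n → (f i, f (i + 1)) ∈ S \ P := by
      intro i hi hin
      refine ⟨hf i hin, fun hp => ?_⟩
      have h2 := (hu i hin hp).1
      have h3 := hS0 (i - 1) (by omega)
      rw [Nat.sub_add_cancel hi, h2, h0] at h3
      exact hS.1 _ h3
    have hpath : ∀ i, i + 1 ≤ n → f 1 = f (i + 1) ∨ (f 1, f (i + 1)) ∈ S \ P := by
      intro i
      induction i with
      | zero => intro _; exact Or.inl rfl
      | succ k ih =>
        intro h
        have h4 := hnot (k + 1) (by omega) (by omega)
        right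
        rcases ih (by omega) with h5 | h5
        · rw [h5]; exact h4
        · exact htr _ _ _ h5 h4
    refine ⟨f n, h0 ▸ hC, ?_⟩
    have h6 := hpath (n - 1) (by omega)
    rw [Nat.sub_add_cancel hn, h1] at h6
    exact h6
  have hdis : ∀ e, e ∈ Pplus → e ∉ CON := by
    intro e h1 h2
    have : e ∈ Pplus ∩ CON := ⟨h1, h2⟩
    rw [hPdisj] at this
    exact this
  have hcase : ∀ u y z, (u, y) ∈ Pplus → (u, z) ∈ CON → ¬ (y = z ∨ (y, z) ∈ S \ P) := by
    rintro u y z h1 h2 (rfl | h3)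
    · exact hdis _ h1 h2
    · refine h3.2 (hCP (Or.inr ?_))
      rw [hQ]
      exact ⟨u, hPsub h1, h3.1, h2, h1⟩
  have hprot : ∀ x y, (x, y) ∈ Pplus → (x, y) ∉ P := by
    intro x y h1 h2
    obtain ⟨z, hz | hz, hyz⟩ := key x y h2
    · exact hcase _ _ _ h1 hz hyz
    · rw [hQ] at hz
      obtain ⟨u, -, -, hu, hux⟩ := hz
      exact hcase _ _ _ (hPtrans _ _ _ hux h1) hu hyz
  refine ⟨⟨⟨fun e he => hCP (Or.inl he), hPS, hirr, htr⟩, ?_⟩, ?_⟩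
  · rintro P' ⟨hsub, hns⟩ ⟨hC', -, -, htr'⟩
    apply hns
    rintro ⟨x, y⟩ hxy
    by_contra hnot
    obtain ⟨z, hz, hyz⟩ := key x y hxy
    have hxz : (x, z) ∈ S \ P' := by
      rcases hyz with rfl | h
      · exact ⟨hPS hxy, hnot⟩
      · exact htr' _ _ _ ⟨hPS hxy, hnot⟩ ⟨h.1, fun h' => h.2 (hsub h')⟩
    rcases hz with hz | hz
    · exact hxz.2 (hC' hz)
    · rw [hQ] at hz
      obtain ⟨u, hS', -, hu, hux⟩ := hz
      exact (htr' u x z ⟨hS', fun h' => hprot _ _ hux (hsub h')⟩ hxz).2 (hC' hu)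
  · ext ⟨x, y⟩
    simp only [Set.mem_inter_iff, Set.mem_empty_iff_false, iff_false, not_and]
    exact hprot x y
end

section
/- Let CON be a finitely stratifiable base contractor of a preference relation ≻ on U. Then the full meet contractor of ≻ by CON (the union of all minimal full contractors of ≻ by CON) equals P^m = {(x,y) | ∃(u,v) ∈ CON such that u ⪰ x ≻ y ⪰ v, ((u,x) ∈ ≻ − CON or u = x), and ((y,v) ∈ ≻ − CON or y = v)}. -/
variable {U : Type*}

theorem full_meet_contractor_eq (S CON : Set (U × U))
    (hS : IsSPO S) (hCON : CON ⊆ S) (hfs : FinStratifiable S CON) :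
    ⋃₀ {P | MinimalFullContractor S CON P} =
      {e : U × U | ∃ u v, (u, v) ∈ CON ∧
        ((u, e.1) ∈ S ∨ u = e.1) ∧ (e.1, e.2) ∈ S ∧ ((e.2, v) ∈ S ∨ e.2 = v) ∧
        ((u, e.1) ∈ S \ CON ∨ u = e.1) ∧ ((e.2, v) ∈ S \ CON ∨ e.2 = v)} := by
  obtain ⟨hirr, htr⟩ := hS
  ext ⟨x, y⟩
  simp only [Set.mem_sUnion, Set.mem_setOf_eq]
  constructor
  · rintro ⟨P, ⟨⟨hCP, hPS, hQi, hQt⟩, hmin⟩, hxy⟩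
    have hxyS := hPS hxy
    by_contra hno
    let Q' : Set (U × U) := {e | e ∈ S \ P ∨
      (((e.1, x) ∈ S \ P ∨ e.1 = x) ∧ ((y, e.2) ∈ S \ P ∨ y = e.2))}
    have hQ'S : Q' ⊆ S := by
      rintro ⟨a, b⟩ (h | ⟨h1, h2⟩)
      · exact h.1
      · simp only at h1 h2
        have h3 : (a, y) ∈ S := by
          rcases h1 with h1 | rfl
          · exact htr _ _ _ h1.1 hxyS
          · exact hxyS
        rcases h2 with h2 | rfl
        · exact htr _ _ _ h3 h2.1
        · exact h3
    have hcon : ∀ a b, (a, b) ∈ CON → (a, b) ∉ Q' := by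
      rintro a b hab (h | ⟨h1, h2⟩)
      · exact h.2 (hCP hab)
      · simp only at h1 h2
        apply hno
        refine ⟨a, b, hab, h1.imp_left (·.1), hxyS, h2.imp_left (·.1),
          h1.imp_left fun h => ⟨h.1, fun hc => h.2 (hCP hc)⟩,
          h2.imp_left fun h => ⟨h.1, fun hc => h.2 (hCP hc)⟩⟩
    have hyx : (y, x) ∉ S := fun h => hirr _ (htr _ _ _ h hxyS)
    have hne : y ≠ x := by rintro rfl; exact hirr _ hxyS
    apply hmin (S \ Q')
    · refine ⟨?_, fun h => ?_⟩
      · rintro e ⟨h1, h2⟩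
        by_contra h3
        exact h2 (Or.inl ⟨h1, h3⟩)
      · exact (h hxy).2 (Or.inr ⟨Or.inr rfl, Or.inr rfl⟩)
    · refine ⟨fun ⟨a, b⟩ h => ⟨hCON h, hcon a b h⟩, Set.diff_subset, ?_⟩
      rw [Set.diff_diff_cancel_left hQ'S]
      refine ⟨fun a h => hirr a (hQ'S h), ?_⟩
      rintro a b c (h | ⟨h1, h2⟩) (h' | ⟨h1', h2'⟩)
      · exact Or.inl (hQt _ _ _ h h')
      · refine Or.inr ⟨Or.inl ?_, h2'⟩
        simp only at h1'
        rcases h1' with h1' | rfl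
        · exact hQt _ _ _ h h1'
        · exact h
      · refine Or.inr ⟨h1, Or.inl ?_⟩
        simp only at h2
        rcases h2 with h2 | rfl
        · exact hQt _ _ _ h2 h'
        · exact h'
      · exact Or.inr ⟨h1, h2'⟩
  · rintro ⟨u, v, huv, -, hxy, -, h1, h2⟩
    have huvS := hCON huv
    let F : Set (Set (U × U)) := {Q | Q ⊆ S ∧ (∀ e ∈ Q, e ∉ CON) ∧
      ∀ a b c, (a, b) ∈ Q → (b, c) ∈ Q → (a, c) ∈ Q}
    let Q0 : Set (U × U) := {e | e ∈ S \ CON ∧ (e = (u, x) ∨ e = (y, v))}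
    have h0 : Q0 ∈ F := by
      refine ⟨fun e h => h.1.1, fun e h => h.1.2, ?_⟩
      rintro a b c ⟨⟨hs, hc⟩, h⟩ ⟨⟨hs', hc'⟩, h'⟩
      exfalso
      simp only [Prod.mk.injEq] at h h'
      rcases h with ⟨rfl, rfl⟩ | ⟨rfl, rfl⟩ <;> rcases h' with ⟨h3, rfl⟩ | ⟨h3, rfl⟩ <;>
        subst h3 <;> first | exact hirr _ hs | exact hirr _ hxy | exact hirr _ huvS
    obtain ⟨Q, h0Q, ⟨hQS, hQC, hQt⟩, hmax⟩ := zorn_subset_nonempty F (by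
      intro c hc hch hne
      refine ⟨⋃₀ c, ⟨?_, ?_, ?_⟩, fun s hs => Set.subset_sUnion_of_mem hs⟩
      · exact Set.sUnion_subset fun s hs => (hc hs).1
      · rintro e ⟨s, hs, he⟩
        exact (hc hs).2.1 e he
      · rintro a b d ⟨s, hs, he⟩ ⟨t, ht, he'⟩
        rcases hch.total hs ht with h | h
        · exact ⟨t, ht, (hc ht).2.2 _ _ _ (h he) he'⟩
        · exact ⟨s, hs, (hc hs).2.2 _ _ _ he (h he')⟩) Q0 h0
    refine ⟨S \ Q, ⟨⟨fun e h => ⟨hCON h, fun h' => hQC e h' h⟩, Set.diff_subset, ?_⟩, ?_⟩,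
      hxy, fun hQ => ?_⟩
    · rw [Set.diff_diff_cancel_left hQS]
      exact ⟨fun a h => hirr a (hQS h), hQt⟩
    · rintro P' ⟨hsub, hns⟩ ⟨hc1, hc2, hc3⟩
      apply hns
      have := hmax (y := S \ P') ⟨Set.diff_subset, fun e h hc => h.2 (hc1 hc), hc3.2⟩
        (fun e he => ⟨hQS he, fun h => (hsub h).2 he⟩)
      rintro e ⟨he, hn⟩
      by_contra h
      exact hn (this ⟨he, h⟩)
    · have h3 : (u, y) ∈ Q := by
        rcases h1 with h1 | rfl
        · exact hQt _ _ _ (h0Q ⟨h1, Or.inl rfl⟩) hQ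
        · exact hQ
      have h4 : (u, v) ∈ Q := by
        rcases h2 with h2 | rfl
        · exact hQt _ _ _ h3 (h0Q ⟨h2, Or.inr rfl⟩)
        · exact h3
      exact hQC _ h4 huv
end

section
/- Let CON be a finitely stratifiable base contractor of a preference relation ≻ on U, and P⁺ a transitive relation with P⁺ ⊆ ≻ and P⁺ ∩ CON = ∅. Define C_{P⁺} = {(x,y) | ∃(u,v) ∈ CON such that u ⪰ x ≻ y ⪰ v, ((u,x) ∈ P⁺ or u = x), and ((y,v) ∈ P⁺ or y = v)}. Then the P⁺-protecting full meet contractor of ≻ by CON (the union of all P⁺-protecting minimal full contractors of ≻ by CON) equals P^m_{P⁺} = {(x,y) | (x,y) ∉ P⁺ and ∃(u,v) ∈ CON such that u ⪰ x ≻ y ⪰ v, ((u,x) ∈ ≻ − C_{P⁺} or u = x), and ((y,v) ∈ ≻ − C_{P⁺} or y = v)}. -/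
variable {U : Type*}

def extR (R : Set (U × U)) (s t : U) : Set (U × U) :=
  {e | e ∈ R ∨ (((e.1, s) ∈ R ∨ e.1 = s) ∧ ((t, e.2) ∈ R ∨ t = e.2))}

theorem extR_mem (R : Set (U × U)) (s t a b : U) : (a, b) ∈ extR R s t ↔
    ((a, b) ∈ R ∨ (((a, s) ∈ R ∨ a = s) ∧ ((t, b) ∈ R ∨ t = b))) := Iff.rfl

theorem extR_sub {S R : Set (U × U)} {s t : U} (hS : IsSPO S) (hR : R ⊆ S)
    (hst : (s, t) ∈ S) : extR R s t ⊆ S := by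
  rintro ⟨a, b⟩ h
  rw [extR_mem] at h
  obtain ⟨_, hT⟩ := hS
  rcases h with h | ⟨h1 | rfl, h2 | rfl⟩
  · exact hR h
  · exact hT _ _ _ (hR h1) (hT _ _ _ hst (hR h2))
  · exact hT _ _ _ (hR h1) hst
  · exact hT _ _ _ hst (hR h2)
  · exact hst

theorem extR_trans {R : Set (U × U)} {s t : U}
    (hR : ∀ x y z, (x, y) ∈ R → (y, z) ∈ R → (x, z) ∈ R) :
    ∀ x y z, (x, y) ∈ extR R s t → (y, z) ∈ extR R s t → (x, z) ∈ extR R s t := by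
  intro x y z h1 h2
  rw [extR_mem] at *
  grind

theorem step_ext {S R C : Set (U × U)} {s t : U} (hS : IsSPO S) (hR : R ⊆ S)
    (hT : ∀ x y z, (x, y) ∈ R → (y, z) ∈ R → (x, z) ∈ R)
    (hst : (s, t) ∈ S \ C ∨ s = t) :
    ∃ R1 : Set (U × U), R ⊆ R1 ∧ R1 ⊆ S ∧
      (∀ x y z, (x, y) ∈ R1 → (y, z) ∈ R1 → (x, z) ∈ R1) ∧ ((s, t) ∈ R1 ∨ s = t) ∧
      ∀ a b, (a, b) ∈ R1 → (a, b) ∈ R ∨ ((s, t) ∈ S \ C ∧ ((a, s) ∈ R ∨ a = s) ∧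
        ((t, b) ∈ R ∨ t = b)) := by
  rcases hst with h | h
  · refine ⟨extR R s t, fun e he => Or.inl he, extR_sub hS hR h.1, extR_trans hT,
      Or.inl (Or.inr ⟨Or.inr rfl, Or.inr rfl⟩), ?_⟩
    intro a b hab
    rcases hab with hab | hab
    · exact Or.inl hab
    · exact Or.inr ⟨h, hab⟩
  · exact ⟨R, subset_rfl, hR, hT, Or.inr h, fun a b hab => Or.inl hab⟩

theorem spo_sub {S Q : Set (U × U)} (hS : IsSPO S) (hQ : Q ⊆ S)
    (hT : ∀ x y z, (x, y) ∈ Q → (y, z) ∈ Q → (x, z) ∈ Q) : IsSPO Q :=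
  ⟨fun x hx => hS.1 x (hQ hx), hT⟩

theorem detour {S CON P : Set (U × U)} (hS : IsSPO S) (hCON : CON ⊆ S)
    (hP : MinimalFullContractor S CON P) {x y : U} (hxy : (x, y) ∈ P) :
    ∃ u v, (u, v) ∈ CON ∧ ((u, x) ∈ S \ P ∨ u = x) ∧ ((y, v) ∈ S \ P ∨ y = v) := by
  obtain ⟨⟨h1, h2, h3⟩, hm⟩ := hP
  by_contra hno
  have hsub : extR (S \ P) x y ⊆ S := extR_sub hS Set.diff_subset (h2 hxy)
  refine hm (S \ extR (S \ P) x y) ?_ ⟨?_, Set.diff_subset, ?_⟩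
  · refine ⟨?_, fun h => (h hxy).2 (Or.inr ⟨Or.inr rfl, Or.inr rfl⟩)⟩
    intro e he
    by_contra hc
    exact he.2 (Or.inl ⟨he.1, hc⟩)
  · rintro ⟨u, v⟩ he
    refine ⟨hCON he, ?_⟩
    rintro (h | h)
    · exact h.2 (h1 he)
    · exact hno ⟨u, v, he, h⟩
  · rw [Set.sdiff_sdiff_cancel_left hsub]
    exact spo_sub hS hsub (extR_trans h3.2)

theorem exists_max {S CON Q0 : Set (U × U)} (hS : IsSPO S) (hCON : CON ⊆ S)
    (h0 : Q0 ⊆ S) (hT : ∀ x y z, (x, y) ∈ Q0 → (y, z) ∈ Q0 → (x, z) ∈ Q0)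
    (hd : ∀ e ∈ Q0, e ∉ CON) :
    ∃ P, MinimalFullContractor S CON P ∧ ∀ e ∈ Q0, e ∉ P := by
  obtain ⟨M, hQM, hM⟩ := zorn_subset_nonempty
    {Q : Set (U × U) | Q ⊆ S ∧ (∀ x y z, (x, y) ∈ Q → (y, z) ∈ Q → (x, z) ∈ Q) ∧
      ∀ e ∈ Q, e ∉ CON} (by
    intro c hc hch hne
    refine ⟨⋃₀ c, ⟨Set.sUnion_subset fun q hq => (hc hq).1, ?_, ?_⟩,
      fun q hq => Set.subset_sUnion_of_mem hq⟩
    · rintro x y z ⟨q, hq, hxy⟩ ⟨r, hr, hyz⟩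
      rcases hch.total hq hr with h | h
      · exact ⟨r, hr, (hc hr).2.1 _ _ _ (h hxy) hyz⟩
      · exact ⟨q, hq, (hc hq).2.1 _ _ _ hxy (h hyz)⟩
    · rintro e ⟨q, hq, he⟩
      exact (hc hq).2.2 e he) Q0 ⟨h0, hT, hd⟩
  obtain ⟨⟨m1, m2, m3⟩, hmax⟩ := hM
  refine ⟨S \ M, ⟨⟨fun e he => ⟨hCON he, fun h => m3 e h he⟩, Set.diff_subset, ?_⟩, ?_⟩,
    fun e he h => h.2 (hQM he)⟩
  · rw [Set.sdiff_sdiff_cancel_left m1]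
    exact spo_sub hS m1 m2
  · rintro P' ⟨hs, hns⟩ ⟨c1, c2, c3⟩
    have := hmax (y := S \ P') ⟨Set.diff_subset, c3.2, fun e he h => he.2 (c1 h)⟩
      (fun e he => ⟨m1 he, fun h => (hs h).2 he⟩)
    apply hns
    intro e he
    by_contra hc
    exact he.2 (this ⟨he.1, hc⟩)

theorem protecting_full_meet_contractor_eq (S CON Pplus CPp : Set (U × U))
    (hS : IsSPO S) (hCON : CON ⊆ S) (hfs : FinStratifiable S CON)
    (hPtrans : ∀ x y z, (x, y) ∈ Pplus → (y, z) ∈ Pplus → (x, z) ∈ Pplus)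
    (hPsub : Pplus ⊆ S) (hPdisj : Pplus ∩ CON = ∅)
    (hC : CPp = {e : U × U | ∃ u v, (u, v) ∈ CON ∧
      ((u, e.1) ∈ S ∨ u = e.1) ∧ (e.1, e.2) ∈ S ∧ ((e.2, v) ∈ S ∨ e.2 = v) ∧
      ((u, e.1) ∈ Pplus ∨ u = e.1) ∧ ((e.2, v) ∈ Pplus ∨ e.2 = v)}) :
    ⋃₀ {P | MinimalFullContractor S CON P ∧ Pplus ∩ P = ∅} =
      {e : U × U | e ∉ Pplus ∧ ∃ u v, (u, v) ∈ CON ∧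
        ((u, e.1) ∈ S ∨ u = e.1) ∧ (e.1, e.2) ∈ S ∧ ((e.2, v) ∈ S ∨ e.2 = v) ∧
        ((u, e.1) ∈ S \ CPp ∨ u = e.1) ∧ ((e.2, v) ∈ S \ CPp ∨ e.2 = v)} := by
  obtain ⟨hI, hST⟩ := id hS
  have hdj : ∀ e, e ∈ Pplus → e ∉ CON := fun e h1 h2 => by
    have : e ∈ Pplus ∩ CON := ⟨h1, h2⟩
    rw [hPdisj] at this
    exact this
  ext ⟨x, y⟩
  constructor
  · rintro ⟨P, ⟨hP, hPP⟩, hxy⟩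
    have hnp : ∀ e, e ∈ Pplus → e ∉ P := fun e h1 h2 => by
      have : e ∈ Pplus ∩ P := ⟨h1, h2⟩
      rw [hPP] at this
      exact this
    have hCP : CPp ⊆ P := by
      rw [hC]
      rintro ⟨a, b⟩ ⟨u, v, huv, -, hab, -, h1, h2⟩
      by_contra hc
      have hT := hP.1.2.2.2
      have hab' : (a, b) ∈ S \ P := ⟨hab, hc⟩
      have hub : (u, b) ∈ S \ P := by
        rcases h1 with h1 | h1
        · exact hT _ _ _ ⟨hPsub h1, hnp _ h1⟩ hab'
        · exact h1 ▸ hab'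
      have huv' : (u, v) ∈ S \ P := by
        rcases h2 with h2 | h2
        · exact hT _ _ _ hub ⟨hPsub h2, hnp _ h2⟩
        · exact h2 ▸ hub
      exact huv'.2 (hP.1.1 huv)
    obtain ⟨u, v, huv, h1, h2⟩ := detour hS hCON hP hxy
    have hsd : S \ P ⊆ S \ CPp := fun e he => ⟨he.1, fun h => he.2 (hCP h)⟩
    exact ⟨fun h => hnp _ h hxy, u, v, huv, h1.imp_left (fun h => h.1), hP.1.2.1 hxy,
      h2.imp_left (fun h => h.1), h1.imp_left (fun h => hsd h), h2.imp_left (fun h => hsd h)⟩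
  · rintro ⟨hnP, u, v, huv, h1, hxy, h2, h3, h4⟩
    dsimp only at h1 hxy h2 h3 h4
    have huvS := hCON huv
    have hvu : ¬ ((v, u) ∈ Pplus ∨ v = u) := by
      rintro (h | h)
      · exact hI _ (hST _ _ _ huvS (hPsub h))
      · exact hI u (h ▸ huvS)
    have hxy' : ¬ ((x, y) ∈ Pplus ∨ x = y) := by
      rintro (h | h)
      · exact hnP h
      · exact hI x (by simpa [← h] using hxy)
    have hCC : ∀ s t a b, (s, t) ∈ S \ CPp → ((a, s) ∈ Pplus ∨ a = s) →
        ((t, b) ∈ Pplus ∨ t = b) → (a, b) ∉ CON := by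
      intro s t a b hst ha hb hab
      apply hst.2
      rw [hC]
      exact ⟨a, b, hab, ha.imp_left (fun h => hPsub h), hst.1,
        hb.imp_left (fun h => hPsub h), ha, hb⟩
    obtain ⟨R1, a1, a2, a3, a4, a5⟩ := step_ext hS hPsub hPtrans h3
    obtain ⟨R2, b1, b2, b3, b4, b5⟩ := step_ext hS a2 a3 h4
    obtain ⟨P, hP, hQ⟩ := exists_max hS hCON b2 b3 (by
      rintro ⟨a, b⟩ hab
      rcases b5 a b hab with h | ⟨hyv, ha, hb⟩
      · rcases a5 a b h with h | ⟨hux, ha, hb⟩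
        · exact hdj _ h
        · exact hCC _ _ _ _ hux ha hb
      · refine hCC _ _ _ _ hyv ?_ ?_
        · rcases ha with h | h
          · rcases a5 _ _ h with h | ⟨_, _, hb⟩
            · exact Or.inl h
            · exact absurd hb hxy'
          · exact Or.inr h
        · rcases hb with h | h
          · rcases a5 _ _ h with h | ⟨_, ha, _⟩
            · exact Or.inl h
            · exact absurd ha hvu
          · exact Or.inr h)
    refine ⟨P, ⟨hP, ?_⟩, ?_⟩
    · ext e
      simp only [Set.mem_inter_iff, Set.mem_empty_iff_false, iff_false]
      rintro ⟨h, h'⟩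
      exact hQ e (b1 (a1 h)) h'
    · by_contra hc
      have hT := hP.1.2.2.2
      have hab' : (x, y) ∈ S \ P := ⟨hxy, hc⟩
      have hub : (u, y) ∈ S \ P := by
        rcases a4 with h | h
        · exact hT _ _ _ ⟨a2 h, hQ _ (b1 h)⟩ hab'
        · exact h ▸ hab'
      have huv' : (u, v) ∈ S \ P := by
        rcases b4 with h | h
        · exact hT _ _ _ hub ⟨b2 h, hQ _ h⟩
        · exact h ▸ hub
      exact huv'.2 (hP.1.1 huv)
end

section
/- Let ≻ be a preference relation on U, P⁻ a full contractor of ≻ by a base contractor CON, ≻' = ≻ − P⁻, and r ⊆ U a finite set of tuples. If no element of w_≻(r) is the start node of a P⁻-edge (i.e., w_≻(r) ∩ S(P⁻) = ∅), then w_≻(r) = w_{≻'}(r). -/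
variable {U : Type*}

/-- The winnow operator: the undominated tuples of `r` w.r.t. `R`. -/
def winnow (R : Set (U × U)) (r : Set U) : Set U :=
  {t ∈ r | ¬ ∃ t' ∈ r, (t', t) ∈ R}

theorem winnow_eq_of_no_contracted_starts (S CON P : Set (U × U))
    (hS : IsSPO S) (hCON : CON ⊆ S) (hFC : FullContractor S CON P)
    (r : Set U) (hr : r.Finite)
    (h : winnow S r ∩ {x | ∃ y, (x, y) ∈ P} = ∅) :
    winnow S r = winnow (S \ P) r := by
  have dom : ∀ t ∈ r, t ∈ winnow S r ∨ ∃ m ∈ winnow S r, (m, t) ∈ S := by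
    have : IsStrictOrder U (fun a b => (a, b) ∈ S) :=
      { irrefl := hS.1, trans := hS.2 }
    have wf : r.WellFoundedOn (fun a b => (a, b) ∈ S) := hr.wellFoundedOn
    intro t ht
    refine wf.induction (P := fun t => t ∈ winnow S r ∨ ∃ m ∈ winnow S r, (m, t) ∈ S) ht ?_
    intro t ht ih
    by_cases hd : ∃ t' ∈ r, (t', t) ∈ S
    · obtain ⟨t', ht', hts⟩ := hd
      rcases ih t' ht' hts with h1 | ⟨m, hm, hmt⟩
      · exact Or.inr ⟨t', h1, hts⟩
      · exact Or.inr ⟨m, hm, hS.2 _ _ _ hmt hts⟩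
    · exact Or.inl ⟨ht, hd⟩
  apply Set.Subset.antisymm
  · rintro t ⟨ht, hn⟩
    exact ⟨ht, fun ⟨t', ht', hs⟩ => hn ⟨t', ht', hs.1⟩⟩
  · rintro t ⟨ht, hn⟩
    rcases dom t ht with h1 | ⟨m, hm, hmt⟩
    · exact h1
    · exact absurd ⟨m, hm.1, hmt, fun hp =>
        (Set.eq_empty_iff_forall_notMem.mp h m) ⟨hm, t, hp⟩⟩ hn
end

section
/- Let ≻ be a preference relation on U, P⁻ a full contractor of ≻ by a base contractor CON, ≻' = ≻ − P⁻, and r ⊆ U a finite set of tuples. Then w_{≻'}(r) = w_{≻'}(w_≻(r) ∪ (r ∩ E(P⁻))), where E(P⁻) = {y | ∃x, (x,y) ∈ P⁻} is the set of end nodes of P⁻-edges. -/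
variable {U : Type*}

theorem winnow_contracted_via_end_nodes (S CON P : Set (U × U))
    (hS : IsSPO S) (hCON : CON ⊆ S) (hFC : FullContractor S CON P)
    (r : Set U) (hr : r.Finite) :
    winnow (S \ P) r =
      winnow (S \ P) (winnow S r ∪ (r ∩ {y | ∃ x, (x, y) ∈ P})) := by
  obtain ⟨-, -, hirr, htr⟩ := hFC
  have key : ∀ t ∈ winnow (S \ P) r, t ∈ winnow S r ∪ (r ∩ {y | ∃ x, (x, y) ∈ P}) := by
    rintro t ⟨htr, hmax⟩
    by_cases h : ∃ x ∈ r, (x, t) ∈ S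
    · obtain ⟨x, hx, hxt⟩ := h
      refine Or.inr ⟨htr, x, ?_⟩
      by_contra hP
      exact hmax ⟨x, hx, hxt, hP⟩
    · exact Or.inl ⟨htr, h⟩
  have sub : ∀ t ∈ winnow S r ∪ (r ∩ {y | ∃ x, (x, y) ∈ P}), t ∈ r := by
    rintro t (h | h)
    · exact h.1
    · exact h.1
  ext t
  constructor
  · intro h
    refine ⟨key t h, ?_⟩
    rintro ⟨x, hx, hxt⟩
    exact h.2 ⟨x, sub x hx, hxt⟩
  · rintro ⟨ht, hmax⟩
    refine ⟨sub t ht, ?_⟩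
    rintro ⟨x, hx, hxt⟩
    let R : U → U → Prop := fun a b => (a, b) ∈ S \ P
    haveI : IsStrictOrder U R := { irrefl := hirr, trans := htr }
    have hwf : r.WellFoundedOn R := hr.wellFoundedOn
    obtain ⟨m, hm, hmin⟩ := WellFounded.has_min hwf {y : r | R y t} ⟨⟨x, hx⟩, hxt⟩
    refine hmax ⟨m, key m ⟨m.2, ?_⟩, hm⟩
    rintro ⟨y, hy, hym⟩
    exact hmin ⟨y, hy⟩ (htr _ _ _ hym hm) hym
end

section
/- Let R₁, …, R_l (l ≥ 1) be binary relations on a set U and let R = R₁ ∪ … ∪ R_l be a strict partial order. Then there is a constant bounding the length of all R-paths if and only if for every i ∈ {1, …, l} there is a constant bounding the length of all Rᵢ-paths. -/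
variable {U : Type*}

theorem exists_rank_of_bounded (R : Set (U × U)) (k : ℕ)
    (hk : ∀ (f : ℕ → U) (n : ℕ), IsPathFun R f n → n ≤ k) :
    ∃ h : U → Fin (k + 1), ∀ u v, (u, v) ∈ R → h u < h v := by
  classical
  let S : U → Set ℕ := fun u => {n | ∃ f : ℕ → U, f n = u ∧ ∀ j < n, (f j, f (j + 1)) ∈ R}
  have hS : ∀ u, ∀ n ∈ S u, n ≤ k := by
    rintro u n ⟨f, -, hf⟩
    rcases Nat.eq_zero_or_pos n with h | h
    · omega
    · exact hk f n ⟨h, hf⟩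
  have hne : ∀ u, (S u).Nonempty := fun u => ⟨0, fun _ => u, rfl, fun j hj => by omega⟩
  have hb : ∀ u, BddAbove (S u) := fun u => ⟨k, fun n hn => hS u n hn⟩
  have hm : ∀ u, sSup (S u) ∈ S u := fun u => Nat.sSup_mem (hne u) (hb u)
  refine ⟨fun u => ⟨sSup (S u), Nat.lt_succ_of_le (hS u _ (hm u))⟩, fun u v huv => ?_⟩
  show sSup (S u) < sSup (S v)
  obtain ⟨f, hfu, hf⟩ := hm u
  generalize sSup (S u) = n at *
  have : n + 1 ∈ S v := by
    refine ⟨fun j => if j ≤ n then f j else v, by simp, fun j hj => ?_⟩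
    rcases Nat.lt_or_ge j n with h | h
    · have h1 : j ≤ n := by omega
      have h2 : j + 1 ≤ n := by omega
      simpa [h1, h2] using hf j h
    · have : j = n := by omega
      subst this
      simpa [hfu] using huv
  exact le_csSup (hb v) this

theorem bounded_paths_union_iff (l : ℕ) (hl : 1 ≤ l) (R : Fin l → Set (U × U))
    (hSPO : IsSPO (⋃ i, R i)) :
    (∃ k, ∀ (f : ℕ → U) (n : ℕ), IsPathFun (⋃ i, R i) f n → n ≤ k) ↔
      ∀ i, ∃ k, ∀ (f : ℕ → U) (n : ℕ), IsPathFun (R i) f n → n ≤ k := by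
  constructor
  · rintro ⟨k, hk⟩ i
    exact ⟨k, fun f n hf => hk f n ⟨hf.1, fun j hj => Set.mem_iUnion.2 ⟨i, hf.2 j hj⟩⟩⟩
  · intro H
    choose k hk using H
    choose h hh using fun i => exists_rank_of_bounded (R i) (k i) (hk i)
    refine ⟨Fintype.card (∀ i, Fin (k i + 1)), fun f n hf => ?_⟩
    have key : ∀ a d, a + d + 1 ≤ n → (f a, f (a + d + 1)) ∈ ⋃ i, R i := by
      intro a d
      induction d with
      | zero => intro hd; exact hf.2 a (by omega)
      | succ d ih =>
        intro hd
        exact hSPO.2 _ _ _ (ih (by omega)) (hf.2 (a + d + 1) (by omega))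
    have ne : ∀ a b, a < b → b ≤ n → (fun i => h i (f a)) ≠ (fun i => h i (f b)) := by
      intro a b hab hbn heq
      obtain ⟨d, rfl⟩ := Nat.exists_eq_add_of_lt hab
      obtain ⟨i, hi⟩ := Set.mem_iUnion.1 (key a d hbn)
      exact absurd (congrFun heq i) (hh i _ _ hi).ne
    have inj : Function.Injective (fun (a : Fin n) => (fun i => h i (f a))) := by
      intro a b hab
      rcases lt_trichotomy a b with hlt | heq | hgt
      · exact absurd hab (ne a b hlt b.2.le)
      · exact heq
      · exact absurd hab.symm (ne b a hgt a.2.le)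
    simpa using Fintype.card_le_of_injective _ inj
end

section
/- Let R₁, …, R_l (l ≥ 1) be binary relations on a set U, let R = R₁ ∪ … ∪ R_l be a strict partial order, and let k ≥ 0 be an integer such that for every i ∈ {1, …, l} every Rᵢ-path has length at most k. Then every R-path has length at most (Σ_{i=1}^{(k+2)l+1} l^i) − 2. -/
variable {U : Type*}

theorem bounded_paths_union_quantitative (l : ℕ) (hl : 1 ≤ l)
    (R : Fin l → Set (U × U)) (hSPO : IsSPO (⋃ i, R i)) (k : ℕ)
    (hk : ∀ i, ∀ (f : ℕ → U) (n : ℕ), IsPathFun (R i) f n → n ≤ k) :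
    ∀ (f : ℕ → U) (n : ℕ), IsPathFun (⋃ i, R i) f n →
      n ≤ (∑ i ∈ Finset.Icc 1 ((k + 2) * l + 1), l ^ i) - 2 := by
  intro f n hf
  classical
  let P : Fin l → U → ℕ → Prop := fun c x m =>
    ∃ g : ℕ → U, g m = x ∧ ∀ t < m, (g t, g (t + 1)) ∈ R c
  have hP : ∀ c x m, P c x m → m ≤ k := by
    rintro c x m ⟨g, -, hg⟩
    rcases Nat.eq_zero_or_pos m with h | h
    · omega
    · exact hk c g m ⟨h, hg⟩
  have hP0 : ∀ c x, P c x 0 := fun c x => ⟨fun _ => x, rfl, fun t ht => by omega⟩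
  let r : Fin l → U → ℕ := fun c x => Nat.findGreatest (P c x) k
  have hr : ∀ c x y, (x, y) ∈ R c → r c x < r c y := by
    intro c x y hxy
    obtain ⟨g, hg1, hg2⟩ : P c x (r c x) :=
      Nat.findGreatest_spec (P := P c x) (Nat.zero_le k) (hP0 c x)
    have h1 : P c y (r c x + 1) := by
      refine ⟨fun t => if t ≤ r c x then g t else y, by simp, ?_⟩
      intro t ht
      rcases Nat.lt_or_ge t (r c x) with h | h
      · have h2 : t ≤ r c x := h.le
        have h3 : t + 1 ≤ r c x := h
        simpa only [h2, h3, if_true] using hg2 t h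
      · have h2 : t = r c x := by omega
        subst h2
        simpa [hg1] using hxy
    exact Nat.le_findGreatest (hP c y _ h1) h1
  have htr : ∀ i d, i + d + 1 ≤ n → (f i, f (i + d + 1)) ∈ ⋃ c, R c := by
    intro i d
    induction d with
    | zero => intro h; exact hf.2 i (by omega)
    | succ d ih =>
      intro h
      exact hSPO.2 _ _ _ (ih (by omega)) (hf.2 (i + d + 1) (by omega))
  have hne : ∀ i j, i < j → j ≤ n → ∃ c, r c (f i) < r c (f j) := by
    intro i j hij hj
    obtain ⟨d, rfl⟩ := Nat.exists_eq_add_of_lt hij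
    obtain ⟨c, hc⟩ := Set.mem_iUnion.1 (htr i d hj)
    exact ⟨c, hr c _ _ hc⟩
  let F : Fin (n + 1) → (Fin l → Fin (k + 1)) := fun i c =>
    ⟨r c (f i), Nat.lt_succ_of_le (Nat.findGreatest_le k)⟩
  have hF : Function.Injective F := by
    intro i j hij
    have he : ∀ c, r c (f i) = r c (f j) := fun c => congrArg Fin.val (congrFun hij c)
    rcases lt_trichotomy i j with h | h | h
    · obtain ⟨c, hc⟩ := hne i j h (by omega)
      have := he c
      omega
    · exact h
    · obtain ⟨c, hc⟩ := hne j i h (by omega)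
      have := he c
      omega
  have hcard : n + 1 ≤ (k + 1) ^ l := by
    simpa using Fintype.card_le_of_injective F hF
  rcases Nat.lt_or_ge 1 l with h2 | h2
  · have h3 : k + 1 ≤ l ^ (k + 2) := by
      have a := Nat.lt_pow_self h2 (n := k + 2)
      omega
    have h4 : (k + 1) ^ l ≤ l ^ ((k + 2) * l) := by
      rw [pow_mul]
      exact Nat.pow_le_pow_left h3 l
    have h5 : l ^ ((k + 2) * l + 1) ≤ ∑ i ∈ Finset.Icc 1 ((k + 2) * l + 1), l ^ i :=
      Finset.single_le_sum (f := fun i => l ^ i) (fun _ _ => Nat.zero_le _) (by simp)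
    have h6 : 2 * l ^ ((k + 2) * l) ≤ l ^ ((k + 2) * l + 1) := by
      rw [pow_succ, mul_comm]
      exact Nat.mul_le_mul_left _ h2
    omega
  · have h3 : l = 1 := by omega
    subst h3
    simp at hcard ⊢
    omega
end

section
/- Let A be a nonempty finite index set, and for each a ∈ A let D_a be a nonempty set and Λ_a a binary relation on D_a. Define the binary relation R on the product Π_{a∈A} D_a by R(o, o') if and only if Λ_a(o(a), o'(a)) for every a ∈ A. Then there is a constant bounding the length of all R-paths if and only if for some a ∈ A there is a constant bounding the length of all Λ_a-paths. -/
variable {U : Type*}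

theorem bounded_paths_product_iff (A : Type*) [Finite A] [Nonempty A]
    (D : A → Type*) (hD : ∀ a, Nonempty (D a)) (Lam : ∀ a, Set (D a × D a)) :
    (∃ k, ∀ (f : ℕ → ∀ a, D a) (n : ℕ),
        IsPathFun {e : (∀ a, D a) × (∀ a, D a) | ∀ a, (e.1 a, e.2 a) ∈ Lam a} f n →
          n ≤ k) ↔
      ∃ a, ∃ k, ∀ (f : ℕ → D a) (n : ℕ), IsPathFun (Lam a) f n → n ≤ k := by
  constructor
  · rintro ⟨k, hk⟩
    by_contra hcon
    push Not at hcon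
    choose g n hg hn using fun a => hcon a k
    have h := hk (fun i a => g a i) (k + 1)
      ⟨by omega, fun i hi a => (hg a).2 i (by have := hn a; omega)⟩
    omega
  · rintro ⟨a, k, hk⟩
    exact ⟨k, fun f n hf => hk (fun i => f i a) n ⟨hf.1, fun i hi => hf.2 i hi a⟩⟩
end

section
/- Let ≻ be a preference relation on U, CON a base contractor of ≻, and P⁺ ⊆ ≻. Define C_{P⁺} = {(x,y) | ∃(u,v) ∈ CON such that u ⪰ x ≻ y ⪰ v, ((u,x) ∈ P⁺ or u = x), and ((y,v) ∈ P⁺ or y = v)}. Then C_{P⁺} is a subset of every P⁺-protecting full contractor of ≻ by CON. -/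
variable {U : Type*}

theorem CPp_subset_protecting_contractors (S CON Pplus : Set (U × U))
    (hS : IsSPO S) (hCON : CON ⊆ S) (hPsub : Pplus ⊆ S) :
    ∀ P, FullContractor S CON P → Pplus ∩ P = ∅ →
      {e : U × U | ∃ u v, (u, v) ∈ CON ∧
        ((u, e.1) ∈ S ∨ u = e.1) ∧ (e.1, e.2) ∈ S ∧ ((e.2, v) ∈ S ∨ e.2 = v) ∧
        ((u, e.1) ∈ Pplus ∨ u = e.1) ∧ ((e.2, v) ∈ Pplus ∨ e.2 = v)} ⊆ P := by
  rintro P ⟨hC, hPS, -, ht⟩ hd ⟨x, y⟩ ⟨u, v, huv, -, hxy, -, h1, h2⟩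
  simp only at hxy h1 h2
  by_contra hn
  have key : ∀ e, e ∈ Pplus → e ∈ S \ P := fun e he =>
    ⟨hPsub he, fun hp => by
      have hm : e ∈ Pplus ∩ P := ⟨he, hp⟩
      rw [hd] at hm
      exact hm⟩
  have hx : (x, y) ∈ S \ P := ⟨hxy, hn⟩
  have huy : (u, y) ∈ S \ P := by
    rcases h1 with h1 | rfl
    · exact ht _ _ _ (key _ h1) hx
    · exact hx
  have hf : (u, v) ∈ S \ P := by
    rcases h2 with h2 | rfl
    · exact ht _ _ _ huy (key _ h2)
    · exact huy
  exact hf.2 (hC huv)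
end
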